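/- Theorem 4.1 (second part). Let k = k(n) be a function with k(n) → ∞ and k(n) = o((n/ln n)^{1/3}) as n → ∞. Then there exists a constant C > 0 such that asymptotically almost surely |ξ(K_n, k)·k/(2 n ln k) − 1| ≤ C/(ln k)^{1/3}; in particular, a.a.s. ξ(K_n,k) ~ 2 n ln k / k. -/

import Mathlib

open Finset Filter

/-- Positions: `p t a` is the vertex (an element of `Fin n`) occupied by agent `a` at the end of
round `t`. `greenSet n k p t` is the set of green agents at the end of round `t`; the initially
green agent is the agent with index `0`, and a white agent becomes green as soon as it occupies
the same vertex as a green agent. -/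
def greenSet (n k : ℕ) (p : ℕ → Fin k → Fin n) : ℕ → Finset (Fin k)
  | 0 => Finset.univ.filter fun a => ∃ b : Fin k, (b : ℕ) = 0 ∧ p 0 a = p 0 b
  | t + 1 =>
      greenSet n k p t ∪
        Finset.univ.filter fun a => ∃ b ∈ greenSet n k p t, p (t + 1) a = p (t + 1) b

/-- The probability that the `k` agents follow the trajectory prefix `p` during rounds
`0, 1, …, T`: each agent starts at a uniformly random vertex of `K_n` and then moves, each round
and independently of everything else, to a uniformly random vertex distinct from its current
one. -/
noncomputable def prefixProb (n k T : ℕ) (p : Fin (T + 1) → Fin k → Fin n) : ℝ :=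
  ∏ a : Fin k, ((n : ℝ)⁻¹ *
    ∏ t : Fin T, if p t.succ a = p t.castSucc a then 0 else ((n : ℝ) - 1)⁻¹)

/-- `probXiLe n k T` is `P(ξ(K_n, k) ≤ T)`: the probability that the broadcast is complete by
the end of round `T`. -/
noncomputable def probXiLe (n k T : ℕ) : ℝ :=
  ∑ p : Fin (T + 1) → Fin k → Fin n,
    if greenSet n k (fun t a => p ⟨min t T, Nat.lt_succ_of_le (min_le_right t T)⟩ a) T
        = Finset.univ
      then prefixProb n k T p else 0

/-- `probXiEq n k t` is `P(ξ(K_n, k) = t)`. -/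
noncomputable def probXiEq (n k : ℕ) : ℕ → ℝ
  | 0 => probXiLe n k 0
  | t + 1 => probXiLe n k (t + 1) - probXiLe n k t

/-- `probXiMem n k S` is `P(ξ(K_n, k) ∈ S)`: the probability that the broadcasting time of the
process with `k` agents on `K_n` belongs to the set `S ⊆ ℕ`. -/
noncomputable def probXiMem (n k : ℕ) (S : Set ℕ) : ℝ :=
  ∑' t, S.indicator (probXiEq n k) t

/-- `expXi n k = E[ξ(K_n, k)] = ∑_{t ≥ 0} P(ξ(K_n, k) > t)`. -/
noncomputable def expXi (n k : ℕ) : ℝ :=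
  ∑' t, (1 - probXiLe n k t)

/-- The green set one round after it was `S`, when the agents have moved to the positions `q`. -/
def spread {n k : ℕ} (S : Finset (Fin k)) (q : Fin k → Fin n) : Finset (Fin k) :=
  S ∪ Finset.univ.filter fun a => ∃ b ∈ S, q a = q b

lemma sum_prod_split {n k : ℕ} (S : Finset (Fin k)) (κ : Fin k → Fin n → ℝ)
    (φ : ({a // a ∈ S} → Fin n) → Fin k → Fin n → ℝ) :
    ∑ q : Fin k → Fin n, (∏ a, κ a (q a)) *
        ∏ w : {a // a ∉ S}, φ (fun s : {a // a ∈ S} => q s) w (q w) =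
      ∑ r : {a // a ∈ S} → Fin n, (∏ s : {a // a ∈ S}, κ s (r s)) *
        ∏ w : {a // a ∉ S}, ∑ v, κ w v * φ r w v := by
  rw [← (Equiv.piEquivPiSubtypeProd (· ∈ S) (fun _ => Fin n)).symm.sum_comp,
    Fintype.sum_prod_type]
  refine Finset.sum_congr rfl fun r _ => ?_
  rw [Fintype.prod_sum, Finset.mul_sum]
  refine Finset.sum_congr rfl fun q _ => ?_
  rw [← Fintype.prod_subtype_mul_prod_subtype (· ∈ S), mul_assoc, ← Finset.prod_mul_distrib]
  have h1 : ∀ s : {a // a ∈ S},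
      (Equiv.piEquivPiSubtypeProd (· ∈ S) (fun _ => Fin n)).symm (r, q) s = r s := by
    intro s; simp [Equiv.piEquivPiSubtypeProd]
  have h2 : ∀ s : {a // a ∉ S},
      (Equiv.piEquivPiSubtypeProd (· ∈ S) (fun _ => Fin n)).symm (r, q) s = q s := by
    intro s; simp [Equiv.piEquivPiSubtypeProd, s.2]
  simp only [h1, h2]
  congr!

lemma sum_prod_eq_one {ι : Type*} [Fintype ι] [DecidableEq ι] {n : ℕ} {κ : ι → Fin n → ℝ}
    (h1 : ∀ a, ∑ v, κ a v = 1) : ∑ q : ι → Fin n, ∏ a, κ a (q a) = 1 := by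
  rw [← Fintype.prod_sum]; simp [h1]

lemma mem_spread {n k : ℕ} {S : Finset (Fin k)} {q : Fin k → Fin n} {a : Fin k} :
    a ∈ spread S q ↔ a ∈ S ∨ q a ∈ Finset.univ.image fun s : {a // a ∈ S} => q s := by
  simp only [spread, Finset.mem_union, Finset.mem_filter, Finset.mem_univ, true_and,
    Finset.mem_image, Subtype.exists, exists_prop]
  simp only [eq_comm]

lemma pow_card_compl_spread {n k : ℕ} (S : Finset (Fin k)) (q : Fin k → Fin n) (u : ℝ) :
    u ^ (spread S q)ᶜ.card = ∏ w : {a // a ∉ S},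
      if q w ∈ Finset.univ.image (fun s : {a // a ∈ S} => q s) then 1 else u := by
  rw [← Finset.prod_const, ← Finset.prod_subtype Sᶜ (by simp)
    (fun w => if q w ∈ Finset.univ.image (fun s : {a // a ∈ S} => q s) then (1:ℝ) else u)]
  rw [Finset.prod_ite, Finset.prod_const_one, one_mul]
  refine Finset.prod_congr ?_ fun _ _ => rfl
  ext a
  rw [Finset.mem_compl, mem_spread, Finset.mem_filter, Finset.mem_compl, not_or]

lemma card_image_univ_le {n k : ℕ} (S : Finset (Fin k)) (r : {a // a ∈ S} → Fin n) :
    (Finset.univ.image r).card ≤ S.card := by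
  refine Finset.card_image_le.trans ?_
  simp

lemma sum_ite_mem_mul {n : ℕ} (R : Finset (Fin n)) (f : Fin n → ℝ) (a b : ℝ) :
    ∑ v, f v * (if v ∈ R then a else b) = b * ∑ v, f v + (a - b) * ∑ v ∈ R, f v := by
  have : ∀ v, f v * (if v ∈ R then a else b) = b * f v + (a - b) * (if v ∈ R then f v else 0) := by
    intro v; split_ifs <;> ring
  simp only [this, Finset.sum_add_distrib, ← Finset.mul_sum, Finset.sum_ite_mem,
    Finset.univ_inter]

lemma sum_pow_card_compl_spread_le {n k : ℕ} (S : Finset (Fin k)) {κ : Fin k → Fin n → ℝ}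
    {c u : ℝ} (h0 : ∀ a v, 0 ≤ κ a v) (h1 : ∀ a, ∑ v, κ a v = 1) (hc : ∀ a v, κ a v ≤ c)
    (hc0 : 0 ≤ c) (hu0 : 0 ≤ u) (hu1 : u ≤ 1) :
    ∑ q : Fin k → Fin n, (∏ a, κ a (q a)) * u ^ (spread S q)ᶜ.card ≤
      (S.card * c + (1 - S.card * c) * u) ^ Sᶜ.card := by
  simp only [pow_card_compl_spread]
  rw [sum_prod_split S κ fun r _ v => if v ∈ Finset.univ.image r then (1:ℝ) else u]
  have key : ∀ r : {a // a ∈ S} → Fin n, (∏ w : {a // a ∉ S}, ∑ v, κ w v *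
      (if v ∈ Finset.univ.image r then (1:ℝ) else u)) ≤
      (S.card * c + (1 - S.card * c) * u) ^ Sᶜ.card := by
    intro r
    have : Sᶜ.card = Fintype.card {a // a ∉ S} := by
      rw [Fintype.card_subtype]; congr 1; ext; simp
    rw [this, ← Finset.card_univ, ← Finset.prod_const]
    refine Finset.prod_le_prod (fun w _ => Finset.sum_nonneg fun v _ => mul_nonneg (h0 _ _)
      (by split_ifs <;> linarith)) fun w _ => ?_
    rw [sum_ite_mem_mul, h1]
    have h2 : ∑ v ∈ Finset.univ.image r, κ w v ≤ S.card * c := by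
      calc _ ≤ ∑ v ∈ Finset.univ.image r, c := Finset.sum_le_sum fun v _ => hc _ _
        _ = ((Finset.univ.image r).card : ℝ) * c := by simp
        _ ≤ _ := by
          gcongr
          exact card_image_univ_le S r
    nlinarith
  calc _ ≤ ∑ r : {a // a ∈ S} → Fin n, (∏ s : {a // a ∈ S}, κ s (r s)) *
        (S.card * c + (1 - S.card * c) * u) ^ Sᶜ.card := by
        refine Finset.sum_le_sum fun r _ => mul_le_mul_of_nonneg_left (key r) ?_
        exact Finset.prod_nonneg fun _ _ => h0 _ _
    _ = _ := by
        rw [← Finset.sum_mul, sum_prod_eq_one (κ := fun s : {a // a ∈ S} => κ s) fun a => h1 a,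
          one_mul]

lemma sum_inv_card_compl_spread_le {n k : ℕ} (S : Finset (Fin k)) {κ : Fin k → Fin n → ℝ}
    {c : ℝ} (h0 : ∀ a v, 0 ≤ κ a v) (h1 : ∀ a, ∑ v, κ a v = 1) (hc : ∀ a v, κ a v ≤ c)
    (hc0 : 0 ≤ c) (hS : S.card * c < 1) :
    ∑ q : Fin k → Fin n, (∏ a, κ a (q a)) * (((spread S q)ᶜ.card : ℝ) + 1)⁻¹ ≤
      ((1 - S.card * c) * (Sᶜ.card + 1))⁻¹ := by
  have hx : 0 < 1 - S.card * c := by linarith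
  calc _ = ∫ u in (0:ℝ)..1, ∑ q : Fin k → Fin n, (∏ a, κ a (q a)) * u ^ (spread S q)ᶜ.card := by
        rw [intervalIntegral.integral_finsetSum fun q _ => by
          apply Continuous.intervalIntegrable; fun_prop]
        simp [integral_pow]
    _ ≤ ∫ u in (0:ℝ)..1, (S.card * c + (1 - S.card * c) * u) ^ Sᶜ.card := by
        refine intervalIntegral.integral_mono_on zero_le_one ?_ ?_ fun u hu =>
          sum_pow_card_compl_spread_le S h0 h1 hc hc0 hu.1 hu.2
        · apply Continuous.intervalIntegrable; fun_prop
        · apply Continuous.intervalIntegrable; fun_prop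
    _ ≤ _ := by
        rw [intervalIntegral.integral_comp_add_mul (fun y : ℝ => y ^ Sᶜ.card) hx.ne', integral_pow,
          smul_eq_mul, mul_inv, ← one_div ((Sᶜ.card : ℝ) + 1)]
        have : (0:ℝ) ≤ (S.card * c + (1 - S.card * c) * 0) ^ (Sᶜ.card + 1) := by positivity
        have h3 : (S.card * c + (1 - S.card * c) * 1 : ℝ) = 1 := by ring
        rw [h3, one_pow]
        gcongr
        linarith

/-- The potential `i / (k + 1 - i)` grows in expectation by at most a constant factor. -/
lemma sum_lower_potential_le {n k : ℕ} (S : Finset (Fin k)) {κ : Fin k → Fin n → ℝ}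
    {c : ℝ} (h0 : ∀ a v, 0 ≤ κ a v) (h1 : ∀ a, ∑ v, κ a v = 1) (hc : ∀ a v, κ a v ≤ c)
    (hc0 : 0 ≤ c) (hk : k * c < 1) :
    ∑ q : Fin k → Fin n, (∏ a, κ a (q a)) *
        (((spread S q).card : ℝ) / (k + 1 - (spread S q).card)) ≤
      (1 + (k + 1) * c / (1 - k * c)) * ((S.card : ℝ) / (k + 1 - S.card)) := by
  have hcard : ∀ U : Finset (Fin k), (Uᶜ.card : ℝ) = k - U.card := by
    intro U
    rw [Finset.card_compl, Fintype.card_fin, Nat.cast_sub]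
    simpa using Finset.card_le_univ U
  have hle : ∀ U : Finset (Fin k), (U.card : ℝ) ≤ k := by
    intro U
    exact_mod_cast (by simpa using Finset.card_le_univ U)
  have hg : ∀ U : Finset (Fin k), (U.card : ℝ) / (k + 1 - U.card) =
      (k + 1) * ((Uᶜ.card : ℝ) + 1)⁻¹ - 1 := by
    intro U
    have := hle U
    rw [hcard]
    have h2 : (k:ℝ) + 1 - U.card ≠ 0 := by linarith
    have h3 : (k:ℝ) - U.card + 1 ≠ 0 := by linarith
    field_simp
    ring
  have hSk : S.card * c ≤ k * c := mul_le_mul_of_nonneg_right (hle S) hc0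
  have hmain := sum_inv_card_compl_spread_le S h0 h1 hc hc0 (hSk.trans_lt hk)
  calc _ = (k + 1) * (∑ q : Fin k → Fin n, (∏ a, κ a (q a)) *
        (((spread S q)ᶜ.card : ℝ) + 1)⁻¹) - ∑ q : Fin k → Fin n, ∏ a, κ a (q a) := by
        rw [Finset.mul_sum, ← Finset.sum_sub_distrib]
        refine Finset.sum_congr rfl fun q _ => ?_
        rw [hg]; ring
    _ ≤ (k + 1) * ((1 - S.card * c) * (Sᶜ.card + 1))⁻¹ - 1 := by
        rw [sum_prod_eq_one h1]
        gcongr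
    _ = (1 + (k + 1) * c / (1 - S.card * c)) * ((S.card : ℝ) / (k + 1 - S.card)) := by
        have := hle S
        rw [hcard]
        have h2 : (k:ℝ) + 1 - S.card ≠ 0 := by linarith
        have h3 : (k:ℝ) - S.card + 1 ≠ 0 := by linarith
        have h4 : 1 - S.card * c ≠ 0 := by linarith
        field_simp
        ring
    _ ≤ _ := by
        have := hle S
        have h2 : (0:ℝ) < k + 1 - S.card := by linarith
        have h4 : 0 < 1 - k * c := by linarith
        gcongr

lemma prod_one_sub_le {ι : Type*} (s : Finset ι) (y : ι → ℝ) (h0 : ∀ i ∈ s, 0 ≤ y i)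
    (h1 : ∀ i ∈ s, y i ≤ 1) {B : ℝ} (hB : ∑ i ∈ s, y i ≤ B) :
    ∏ i ∈ s, (1 - y i) ≤ 1 - (∑ i ∈ s, y i) / (1 + B) := by
  have hY : 0 ≤ ∑ i ∈ s, y i := Finset.sum_nonneg h0
  have h : ∏ i ∈ s, (1 - y i) ≤ 1 - (∑ i ∈ s, y i) / (1 + ∑ i ∈ s, y i) := by
    clear hB hY
    classical
    induction s using Finset.induction_on with
    | empty => simp
    | insert a s ha ih =>
      rw [Finset.prod_insert ha, Finset.sum_insert ha]
      have ih' := ih (fun i hi => h0 i (Finset.mem_insert_of_mem hi))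
        (fun i hi => h1 i (Finset.mem_insert_of_mem hi))
      have hY : 0 ≤ ∑ i ∈ s, y i :=
        Finset.sum_nonneg fun i hi => h0 i (Finset.mem_insert_of_mem hi)
      have ha0 := h0 a (Finset.mem_insert_self a s)
      have ha1 := h1 a (Finset.mem_insert_self a s)
      generalize ∑ i ∈ s, y i = Y at *
      generalize ∏ i ∈ s, (1 - y i) = P at *
      have e1 : 1 - Y / (1 + Y) = 1 / (1 + Y) := by field_simp; ring
      have e2 : 1 - (y a + Y) / (1 + (y a + Y)) = 1 / (1 + (y a + Y)) := by field_simp; ring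
      rw [e1] at ih'
      rw [e2]
      calc (1 - y a) * P ≤ (1 - y a) * (1 / (1 + Y)) :=
            mul_le_mul_of_nonneg_left ih' (by linarith)
        _ ≤ _ := by
          rw [mul_one_div, div_le_div_iff₀ (by positivity) (by positivity)]
          nlinarith [mul_nonneg ha0 hY, mul_nonneg ha0 ha0]
  refine h.trans ?_
  gcongr

lemma spread_eq_self_indicator {n k : ℕ} (S : Finset (Fin k)) (q : Fin k → Fin n) :
    (if spread S q = S then (1:ℝ) else 0) = ∏ w : {a // a ∉ S},
      if q w ∈ Finset.univ.image (fun s : {a // a ∈ S} => q s) then (0:ℝ) else 1 := by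
  split_ifs with h
  · refine (Finset.prod_eq_one fun w _ => if_neg fun hw => w.2 ?_).symm
    have hmem := mem_spread.2 (Or.inr hw)
    rwa [h] at hmem
  · have : ∃ w, w ∈ spread S q ∧ w ∉ S := by
      by_contra! hcon
      exact h (Finset.Subset.antisymm hcon Finset.subset_union_left)
    obtain ⟨w, hw, hwS⟩ := this
    refine Eq.symm (Finset.prod_eq_zero (Finset.mem_univ (⟨w, hwS⟩ : {a // a ∉ S})) (if_pos ?_))
    exact (mem_spread.1 hw).resolve_left hwS

/-- A vertex is hit by at least one of the agents with about the expected probability. -/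
lemma sum_prod_mem_image_ge {n k : ℕ} (S : Finset (Fin k)) {κ : Fin k → Fin n → ℝ}
    {c : ℝ} (h0 : ∀ a v, 0 ≤ κ a v) (h1 : ∀ a, ∑ v, κ a v = 1) (hc : ∀ a v, κ a v ≤ c)
    (v : Fin n) :
    (∑ a ∈ S, κ a v) / (1 + S.card * c) ≤
      ∑ r : {a // a ∈ S} → Fin n, (∏ s : {a // a ∈ S}, κ s (r s)) *
        (if v ∈ Finset.univ.image r then 1 else 0) := by
  have hone : ∀ a, κ a v ≤ 1 := fun a => by
    rw [← h1 a]; exact Finset.single_le_sum (fun u _ => h0 a u) (Finset.mem_univ v)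
  have hsum : ∑ s : {a // a ∈ S}, κ s v = ∑ a ∈ S, κ a v :=
    (Finset.sum_subtype S (by simp) (fun a => κ a v)).symm
  have hmiss : ∑ r : {a // a ∈ S} → Fin n, (∏ s : {a // a ∈ S}, κ s (r s)) *
      (if v ∈ Finset.univ.image r then 0 else 1) = ∏ s : {a // a ∈ S}, (1 - κ s v) := by
    have : ∀ s : {a // a ∈ S}, 1 - κ s v = ∑ u, κ s u * (if u = v then 0 else 1) := by
      intro s
      have : ∀ u, κ s u * (if u = v then 0 else 1) = κ s u - if u = v then κ s u else 0 := by
        intro u; split_ifs <;> ring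
      simp [this, h1]
    simp only [this]
    rw [Fintype.prod_sum]
    refine Finset.sum_congr rfl fun r _ => ?_
    rw [Finset.prod_mul_distrib]
    congr 1
    split_ifs with h
    · obtain ⟨s, -, hs⟩ := Finset.mem_image.1 h
      exact Eq.symm (Finset.prod_eq_zero (Finset.mem_univ s) (if_pos hs))
    · refine (Finset.prod_eq_one fun s _ => if_neg fun hs => h ?_).symm
      exact Finset.mem_image.2 ⟨s, Finset.mem_univ s, hs⟩
  have hle := prod_one_sub_le Finset.univ (fun s : {a // a ∈ S} => κ s v) (fun s _ => h0 s v)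
    (fun s _ => hone s) (B := S.card * c) (by
      calc ∑ s : {a // a ∈ S}, κ s v ≤ ∑ s : {a // a ∈ S}, c :=
            Finset.sum_le_sum fun s _ => hc s v
        _ = _ := by simp)
  rw [← hmiss, hsum] at hle
  have htot : ∑ r : {a // a ∈ S} → Fin n, (∏ s : {a // a ∈ S}, κ s (r s)) *
        (if v ∈ Finset.univ.image r then (1:ℝ) else 0) +
      ∑ r : {a // a ∈ S} → Fin n, (∏ s : {a // a ∈ S}, κ s (r s)) *
        (if v ∈ Finset.univ.image r then (0:ℝ) else 1) = 1 := by
    refine Eq.trans ?_ (sum_prod_eq_one (κ := fun s : {a // a ∈ S} => κ s) fun a => h1 a)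
    rw [← Finset.sum_add_distrib]
    refine Finset.sum_congr rfl fun r _ => ?_
    split_ifs <;> ring
  linarith

/-- Bound on the probability that no white agent turns green in one round. -/
lemma sum_spread_eq_self_le {n k : ℕ} (S : Finset (Fin k)) {κ : Fin k → Fin n → ℝ}
    {c d : ℝ} (h0 : ∀ a v, 0 ≤ κ a v) (h1 : ∀ a, ∑ v, κ a v = 1) (hc : ∀ a v, κ a v ≤ c)
    (hc0 : 0 ≤ c) (hd : ∀ a b, d ≤ ∑ v, κ a v * κ b v) :
    ∑ q : Fin k → Fin n, (∏ a, κ a (q a)) * (if spread S q = S then 1 else 0) ≤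
      1 - Sᶜ.card * (S.card * d) / (1 + S.card * c) / (1 + Sᶜ.card * (S.card * c)) := by
  simp only [spread_eq_self_indicator]
  rw [sum_prod_split S κ fun r _ v => if v ∈ Finset.univ.image r then (0:ℝ) else 1]
  set B : ℝ := Sᶜ.card * (S.card * c) with hB
  have hB0 : 0 ≤ B := by positivity
  have hcompl : Sᶜ.card = Fintype.card {a // a ∉ S} := by
    rw [Fintype.card_subtype]; congr 1; ext; simp
  have hP : ∀ r : {a // a ∈ S} → Fin n, 0 ≤ ∏ s : {a // a ∈ S}, κ s (r s) :=
    fun r => Finset.prod_nonneg fun _ _ => h0 _ _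
  have key : ∀ r : {a // a ∈ S} → Fin n, (∏ w : {a // a ∉ S}, ∑ v, κ w v *
      (if v ∈ Finset.univ.image r then (0:ℝ) else 1)) ≤
      1 - (∑ w : {a // a ∉ S}, ∑ v ∈ Finset.univ.image r, κ w v) / (1 + B) := by
    intro r
    have e : ∀ w : {a // a ∉ S}, ∑ v, κ w v * (if v ∈ Finset.univ.image r then (0:ℝ) else 1) =
        1 - ∑ v ∈ Finset.univ.image r, κ w v := by
      intro w; rw [sum_ite_mem_mul, h1]; ring
    simp only [e]
    refine prod_one_sub_le _ _ (fun w _ => Finset.sum_nonneg fun v _ => h0 _ _)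
      (fun w _ => ?_) ?_
    · rw [← h1 w]
      exact Finset.sum_le_sum_of_subset_of_nonneg (Finset.subset_univ _) fun v _ _ => h0 _ _
    · calc _ ≤ ∑ w : {a // a ∉ S}, (S.card : ℝ) * c := by
            refine Finset.sum_le_sum fun w _ => ?_
            calc _ ≤ ∑ v ∈ Finset.univ.image r, c := Finset.sum_le_sum fun v _ => hc _ _
              _ = ((Finset.univ.image r).card : ℝ) * c := by simp
              _ ≤ _ := by
                gcongr
                exact card_image_univ_le S r
        _ = B := by rw [hB, hcompl]; simp
  have hmean : Sᶜ.card * (S.card * d) / (1 + S.card * c) ≤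
      ∑ r : {a // a ∈ S} → Fin n, (∏ s : {a // a ∈ S}, κ s (r s)) *
        ∑ w : {a // a ∉ S}, ∑ v ∈ Finset.univ.image r, κ w v := by
    calc _ = ∑ w : {a // a ∉ S}, (∑ a ∈ S, d) / (1 + S.card * c) := by
          rw [hcompl]; simp [mul_div_assoc]
      _ ≤ ∑ w : {a // a ∉ S}, ∑ v, κ w v * ((∑ a ∈ S, κ a v) / (1 + S.card * c)) := by
          refine Finset.sum_le_sum fun w _ => ?_
          simp only [← mul_div_assoc]
          rw [← Finset.sum_div]
          gcongr
          simp only [Finset.mul_sum]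
          rw [Finset.sum_comm]
          exact Finset.sum_le_sum fun a _ => hd _ _
      _ ≤ ∑ w : {a // a ∉ S}, ∑ v, κ w v * ∑ r : {a // a ∈ S} → Fin n,
            (∏ s : {a // a ∈ S}, κ s (r s)) * (if v ∈ Finset.univ.image r then 1 else 0) := by
          gcongr with w _ v _
          · exact h0 _ _
          · exact sum_prod_mem_image_ge S h0 h1 hc v
      _ = _ := by
          have e : ∀ r : {a // a ∈ S} → Fin n, ∀ w : {a // a ∉ S},
              ∑ v ∈ Finset.univ.image r, κ w v =
                ∑ v, κ w v * (if v ∈ Finset.univ.image r then 1 else 0) := by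
            intro r w; rw [sum_ite_mem_mul]; ring
          simp only [e, Finset.mul_sum]
          rw [Finset.sum_comm]
          conv_rhs => rw [Finset.sum_comm]
          rw [Finset.sum_comm]
          refine Finset.sum_congr rfl fun w _ => ?_
          rw [Finset.sum_comm]
          refine Finset.sum_congr rfl fun r _ => Finset.sum_congr rfl fun v _ => ?_
          ring
  calc _ ≤ ∑ r : {a // a ∈ S} → Fin n, (∏ s : {a // a ∈ S}, κ s (r s)) *
        (1 - (∑ w : {a // a ∉ S}, ∑ v ∈ Finset.univ.image r, κ w v) / (1 + B)) :=
        Finset.sum_le_sum fun r _ => mul_le_mul_of_nonneg_left (key r) (hP r)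
    _ = 1 - (∑ r : {a // a ∈ S} → Fin n, (∏ s : {a // a ∈ S}, κ s (r s)) *
        ∑ w : {a // a ∉ S}, ∑ v ∈ Finset.univ.image r, κ w v) / (1 + B) := by
        refine Eq.trans ?_ (congrArg (· - _ / (1 + B))
          (sum_prod_eq_one (κ := fun s : {a // a ∈ S} => κ s) fun a => h1 a))
        rw [Finset.sum_div, ← Finset.sum_sub_distrib]
        refine Finset.sum_congr rfl fun r _ => ?_
        ring
    _ ≤ _ := by gcongr

/-- `centralProd m = ∏_{l = 1}^{m} (1 - 1 / (2 l))`. -/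
noncomputable def centralProd (m : ℕ) : ℝ := ∏ l ∈ Finset.range m, (1 - 1 / (2 * ((l : ℝ) + 1)))

lemma centralProd_succ (m : ℕ) :
    centralProd (m + 1) = centralProd m * (1 - 1 / (2 * ((m : ℝ) + 1))) :=
  Finset.prod_range_succ _ _

lemma centralProd_factor_mem (m : ℕ) :
    0 < 1 - 1 / (2 * ((m : ℝ) + 1)) ∧ 1 - 1 / (2 * ((m : ℝ) + 1)) ≤ 1 := by
  constructor
  · rw [sub_pos, div_lt_one (by positivity)]
    have : (0:ℝ) ≤ m := m.cast_nonneg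
    linarith
  · have : 0 ≤ 1 / (2 * ((m : ℝ) + 1)) := by positivity
    linarith

lemma centralProd_pos (m : ℕ) : 0 < centralProd m :=
  Finset.prod_pos fun l _ => (centralProd_factor_mem l).1

lemma centralProd_antitone : Antitone centralProd :=
  antitone_nat_of_succ_le fun m => by
    rw [centralProd_succ]
    exact mul_le_of_le_one_right (centralProd_pos m).le (centralProd_factor_mem m).2

lemma centralProd_le_one (m : ℕ) : centralProd m ≤ 1 := by
  simpa [centralProd] using centralProd_antitone m.zero_le

lemma centralProd_sq_ge (m : ℕ) : 1 / (4 * ((m : ℝ) + 1)) ≤ centralProd (m + 1) ^ 2 := by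
  induction m with
  | zero => norm_num [centralProd]
  | succ m ih =>
    rw [centralProd_succ, mul_pow]
    refine le_trans ?_ (mul_le_mul_of_nonneg_right ih (sq_nonneg _))
    push_cast
    have : (0:ℝ) ≤ m := m.cast_nonneg
    have e : (1:ℝ) - 1 / (2 * ((m : ℝ) + 1 + 1)) = (2 * m + 3) / (2 * (m + 2)) := by
      field_simp; ring
    rw [e, div_pow, div_mul_div_comm, div_le_div_iff₀ (by positivity) (by positivity)]
    nlinarith [mul_nonneg this this, mul_nonneg (mul_nonneg this this) this]

/-- A potential of the number `i` of green agents which decreases in expectation by a constant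
factor in every round until it vanishes at `i = k`. -/
noncomputable def upperPotential (k i : ℕ) : ℝ :=
  if i < k then centralProd (i - 1) / centralProd (k - i) else 0

lemma upperPotential_nonneg (k i : ℕ) : 0 ≤ upperPotential k i := by
  unfold upperPotential
  split_ifs
  · exact div_nonneg (centralProd_pos _).le (centralProd_pos _).le
  · rfl

lemma upperPotential_anti {k i j : ℕ} (h : i ≤ j) : upperPotential k j ≤ upperPotential k i := by
  by_cases hj : j < k
  · rw [upperPotential, upperPotential, if_pos hj, if_pos (h.trans_lt hj)]
    exact div_le_div₀ (centralProd_pos _).le (centralProd_antitone (by omega)) (centralProd_pos _)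
      (centralProd_antitone (by omega))
  · rw [upperPotential, if_neg hj]
    exact upperPotential_nonneg k i

lemma upperPotential_ge {k i : ℕ} (h : i < k) : centralProd (k - 1) ≤ upperPotential k i := by
  rw [upperPotential, if_pos h, le_div_iff₀ (centralProd_pos _)]
  calc _ ≤ centralProd (k - 1) := mul_le_of_le_one_right (centralProd_pos _).le
        (centralProd_le_one _)
    _ ≤ _ := centralProd_antitone (by omega)

lemma upperPotential_succ_le {k i : ℕ} (hi : 1 ≤ i) (hik : i < k) :
    upperPotential k (i + 1) ≤
      upperPotential k i * (1 - ((k : ℝ) / 2 - 1 / 4) / (i * ((k : ℝ) - i))) := by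
  obtain ⟨a, rfl⟩ : ∃ a, i = a + 1 := ⟨i - 1, by omega⟩
  obtain ⟨b, rfl⟩ : ∃ b, k = a + 1 + (b + 1) := ⟨k - (a + 2), by omega⟩
  have hfac : 1 - (((a + 1 + (b + 1) : ℕ) : ℝ) / 2 - 1 / 4) /
      (((a + 1 : ℕ) : ℝ) * (((a + 1 + (b + 1) : ℕ) : ℝ) - ((a + 1 : ℕ) : ℝ))) =
      (1 - 1 / (2 * ((a : ℝ) + 1))) * (1 - 1 / (2 * ((b : ℝ) + 1))) := by
    push_cast
    have h1 : (a:ℝ) + 1 ≠ 0 := by positivity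
    have h2 : (b:ℝ) + 1 ≠ 0 := by positivity
    have h3 : (a:ℝ) + 1 + (b + 1) - (a + 1) = b + 1 := by ring
    rw [h3]
    field_simp
    ring
  rw [hfac]
  by_cases hlt : a + 1 + 1 < a + 1 + (b + 1)
  · rw [upperPotential, upperPotential, if_pos hlt, if_pos hik]
    have e1 : a + 1 + (b + 1) - (a + 1 + 1) = b := by omega
    have e2 : a + 1 + (b + 1) - (a + 1) = b + 1 := by omega
    rw [e1, e2, Nat.add_sub_cancel, Nat.add_sub_cancel, centralProd_succ, centralProd_succ]
    have h1 := (centralProd_pos b).ne'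
    have h2 := (centralProd_factor_mem b).1.ne'
    refine le_of_eq ?_
    generalize 1 - 1 / (2 * ((b : ℝ) + 1)) = y at *
    field_simp
  · rw [upperPotential, if_neg hlt]
    exact mul_nonneg (upperPotential_nonneg _ _)
      (mul_nonneg (centralProd_factor_mem a).1.le (centralProd_factor_mem b).1.le)

lemma sum_upperPotential_le {n k : ℕ} {S : Finset (Fin k)} (hS : S.Nonempty)
    {κ : Fin k → Fin n → ℝ} {c d : ℝ} (h0 : ∀ a v, 0 ≤ κ a v) (h1 : ∀ a, ∑ v, κ a v = 1)
    (hc : ∀ a v, κ a v ≤ c) (hc0 : 0 ≤ c) (hd0 : 0 ≤ d) (hd : ∀ a b, d ≤ ∑ v, κ a v * κ b v) :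
    ∑ q : Fin k → Fin n, (∏ a, κ a (q a)) * upperPotential k (spread S q).card ≤
      (1 - ((k : ℝ) / 2 - 1 / 4) * d / ((1 + k * c) * (1 + k ^ 2 * c))) *
        upperPotential k S.card := by
  have hsub : ∀ q : Fin k → Fin n, S ⊆ spread S q := fun q => Finset.subset_union_left
  have hi1 : 1 ≤ S.card := hS.card_pos
  have hik : S.card ≤ k := by simpa using Finset.card_le_univ S
  rcases hik.eq_or_lt with heq | hlt
  · have hz : ∀ j, k ≤ j → upperPotential k j = 0 := fun j hj => if_neg (by omega)
    rw [hz _ heq.ge, mul_zero]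
    refine le_of_eq (Finset.sum_eq_zero fun q _ => ?_)
    rw [hz _ (heq.ge.trans (Finset.card_le_card (hsub q))), mul_zero]
  have hstep := upperPotential_succ_le hi1 hlt
  have hanti := upperPotential_anti (k := k) (Nat.le_succ S.card)
  have hnn := upperPotential_nonneg k S.card
  have hP := sum_spread_eq_self_le S h0 h1 hc hc0 hd
  have hcompl : (Sᶜ.card : ℝ) = k - S.card := by
    rw [Finset.card_compl, Fintype.card_fin, Nat.cast_sub hik]
  rw [hcompl] at hP
  have hm : (0:ℝ) < k - S.card := by
    have : (S.card : ℝ) < k := by exact_mod_cast hlt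
    linarith
  have hi : (1:ℝ) ≤ S.card := by exact_mod_cast hi1
  set i : ℝ := (S.card : ℝ) with hidef
  set m : ℝ := k - i with hmdef
  set f := upperPotential k S.card
  set f' := upperPotential k (S.card + 1)
  have hQ : i * m * (d / ((1 + k * c) * (1 + k ^ 2 * c))) ≤
      m * (i * d) / (1 + i * c) / (1 + m * (i * c)) := by
    have e : m * (i * d) / (1 + i * c) / (1 + m * (i * c)) =
        i * m * (d / ((1 + i * c) * (1 + m * (i * c)))) := by
      rw [div_div]; ring
    rw [e]
    have hk0 : (0:ℝ) ≤ k := k.cast_nonneg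
    have hmi : m * (i * c) ≤ k ^ 2 * c := by
      have : m * i ≤ k ^ 2 := by nlinarith
      nlinarith
    have hik' : i ≤ k := by linarith
    gcongr
  calc _ ≤ ∑ q : Fin k → Fin n, (∏ a, κ a (q a)) *
        (f' + (if spread S q = S then 1 else 0) * (f - f')) := by
        refine Finset.sum_le_sum fun q _ => mul_le_mul_of_nonneg_left ?_
          (Finset.prod_nonneg fun _ _ => h0 _ _)
        split_ifs with h
        · rw [h]
          exact le_of_eq (by ring)
        · rw [zero_mul, add_zero]
          exact upperPotential_anti
            (Finset.card_lt_card ((hsub q).ssubset_of_ne (Ne.symm h)))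
    _ = f' + (∑ q : Fin k → Fin n, (∏ a, κ a (q a)) * (if spread S q = S then 1 else 0)) *
        (f - f') := by
        simp only [mul_add, Finset.sum_add_distrib, ← mul_assoc]
        rw [← Finset.sum_mul, ← Finset.sum_mul, sum_prod_eq_one h1, one_mul]
    _ ≤ f' + (1 - i * m * (d / ((1 + k * c) * (1 + k ^ 2 * c)))) * (f - f') := by
        have : 0 ≤ f - f' := by linarith
        gcongr
        linarith
    _ = f - i * m * (d / ((1 + k * c) * (1 + k ^ 2 * c))) * (f - f') := by ring
    _ ≤ f - i * m * (d / ((1 + k * c) * (1 + k ^ 2 * c))) *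
          (f * (((k : ℝ) / 2 - 1 / 4) / (i * m))) := by
        have h2 : f * (((k : ℝ) / 2 - 1 / 4) / (i * m)) ≤ f - f' := by linarith
        have hk0 : (0:ℝ) ≤ k := k.cast_nonneg
        gcongr
    _ = _ := by
        field_simp

/-- The transition probabilities of a single agent on `K_n`. -/
noncomputable def stepProb (n : ℕ) (x y : Fin n) : ℝ := if y = x then 0 else ((n : ℝ) - 1)⁻¹

lemma stepProb_nonneg {n : ℕ} (hn : 2 ≤ n) (x y : Fin n) : 0 ≤ stepProb n x y := by
  have : (2:ℝ) ≤ n := by exact_mod_cast hn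
  unfold stepProb
  split_ifs
  · rfl
  · exact inv_nonneg.2 (by linarith)

lemma stepProb_le {n : ℕ} (hn : 2 ≤ n) (x y : Fin n) : stepProb n x y ≤ ((n : ℝ) - 1)⁻¹ := by
  have : (2:ℝ) ≤ n := by exact_mod_cast hn
  unfold stepProb
  split_ifs
  · exact inv_nonneg.2 (by linarith)
  · rfl

lemma stepProb_eq (n : ℕ) (x y : Fin n) :
    stepProb n x y = ((n : ℝ) - 1)⁻¹ - if y = x then ((n : ℝ) - 1)⁻¹ else 0 := by
  unfold stepProb
  split_ifs <;> ring

lemma sum_stepProb {n : ℕ} (hn : 2 ≤ n) (x : Fin n) : ∑ y, stepProb n x y = 1 := by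
  have : (2:ℝ) ≤ n := by exact_mod_cast hn
  have h : (n:ℝ) - 1 ≠ 0 := by linarith
  simp only [stepProb_eq, Finset.sum_sub_distrib]
  simp
  field_simp

lemma sum_stepProb_mul_ge {n : ℕ} (hn : 2 ≤ n) (x y : Fin n) :
    ((n : ℝ) - 1)⁻¹ * (1 - ((n : ℝ) - 1)⁻¹) ≤ ∑ v, stepProb n x v * stepProb n y v := by
  have h2 : (2:ℝ) ≤ n := by exact_mod_cast hn
  have hc : 0 ≤ ((n : ℝ) - 1)⁻¹ := inv_nonneg.2 (by linarith)
  have e : ∀ v, stepProb n x v * stepProb n y v = ((n : ℝ) - 1)⁻¹ * stepProb n x v -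
      if v = y then ((n : ℝ) - 1)⁻¹ * stepProb n x v else 0 := by
    intro v
    rw [stepProb_eq n y]
    split_ifs <;> ring
  simp only [e, Finset.sum_sub_distrib, ← Finset.mul_sum, sum_stepProb hn]
  simp only [Finset.sum_ite_eq', Finset.mem_univ, if_true]
  nlinarith [mul_le_mul_of_nonneg_left (stepProb_le hn x y) hc]

/-- The expectation of a function of the positions and the green set at the end of round `T`. -/
noncomputable def expState (n k T : ℕ) (F : (Fin k → Fin n) → Finset (Fin k) → ℝ) : ℝ :=
  ∑ p : Fin (T + 1) → Fin k → Fin n, prefixProb n k T p * F (p (Fin.last T))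
    (greenSet n k (fun t a => p ⟨min t T, Nat.lt_succ_of_le (min_le_right t T)⟩ a) T)

lemma prefixProb_nonneg {n : ℕ} (hn : 2 ≤ n) (k T : ℕ) (p : Fin (T + 1) → Fin k → Fin n) :
    0 ≤ prefixProb n k T p := by
  refine Finset.prod_nonneg fun a _ => mul_nonneg (by positivity) ?_
  exact Finset.prod_nonneg fun t _ => stepProb_nonneg hn (p t.castSucc a) (p t.succ a)

lemma greenSet_congr {n k : ℕ} {p p' : ℕ → Fin k → Fin n} {t : ℕ} (h : ∀ s ≤ t, p s = p' s) :
    greenSet n k p t = greenSet n k p' t := by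
  induction t with
  | zero => simp only [greenSet, h 0 le_rfl]
  | succ t ih =>
    simp only [greenSet, ih fun s hs => h s (hs.trans t.le_succ), h (t + 1) le_rfl]

lemma greenSet_succ (n k : ℕ) (p : ℕ → Fin k → Fin n) (t : ℕ) :
    greenSet n k p (t + 1) = spread (greenSet n k p t) (p (t + 1)) := rfl

lemma greenSet_zero {n k : ℕ} (hk : 0 < k) (p : ℕ → Fin k → Fin n) :
    greenSet n k p 0 = spread {(⟨0, hk⟩ : Fin k)} (p 0) := by
  ext a
  simp only [greenSet, spread, Finset.mem_union, Finset.mem_filter, Finset.mem_univ, true_and,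
    Finset.mem_singleton, exists_eq_left]
  constructor
  · rintro ⟨b, hb, h⟩
    right
    rwa [show b = ⟨0, hk⟩ from Fin.ext hb] at h
  · rintro (rfl | h)
    · exact ⟨_, rfl, rfl⟩
    · exact ⟨_, rfl, h⟩

lemma greenSet_nonempty {n k : ℕ} (hk : 0 < k) (p : ℕ → Fin k → Fin n) (t : ℕ) :
    (greenSet n k p t).Nonempty := by
  induction t with
  | zero =>
    rw [greenSet_zero hk]
    exact ⟨_, Finset.mem_union_left _ (Finset.mem_singleton_self _)⟩
  | succ t ih => exact ih.mono Finset.subset_union_left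

lemma prefixProb_snoc {n k T : ℕ} (p : Fin (T + 1) → Fin k → Fin n) (q : Fin k → Fin n) :
    prefixProb n k (T + 1) (Fin.snoc p q : Fin (T + 2) → Fin k → Fin n) =
      prefixProb n k T p * ∏ a, stepProb n (p (Fin.last T) a) (q a) := by
  rw [prefixProb, prefixProb, ← Finset.prod_mul_distrib]
  refine Finset.prod_congr rfl fun a _ => ?_
  rw [Fin.prod_univ_castSucc, mul_assoc]
  have h1 : ∀ t : Fin T, (Fin.snoc p q : Fin (T + 2) → Fin k → Fin n) t.castSucc.succ =
      p t.succ := by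
    intro t
    rw [Fin.succ_castSucc]
    exact Fin.snoc_castSucc (α := fun _ => Fin k → Fin n) q p t.succ
  have h2 : ∀ t : Fin (T + 1), (Fin.snoc p q : Fin (T + 2) → Fin k → Fin n) t.castSucc = p t :=
    fun t => Fin.snoc_castSucc (α := fun _ => Fin k → Fin n) q p t
  have h3 : (Fin.snoc p q : Fin (T + 2) → Fin k → Fin n) (Fin.last T).succ = q :=
    Fin.snoc_last (α := fun _ => Fin k → Fin n) q p
  simp only [h1, h2, h3, stepProb]

lemma expState_succ (n k T : ℕ) (F : (Fin k → Fin n) → Finset (Fin k) → ℝ) :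
    expState n k (T + 1) F = expState n k T fun x S =>
      ∑ q : Fin k → Fin n, (∏ a, stepProb n (x a) (q a)) * F q (spread S q) := by
  rw [expState, ← (Fin.snocEquiv fun _ => Fin k → Fin n).sum_comp, Fintype.sum_prod_type_right,
    expState]
  refine Finset.sum_congr rfl fun p _ => ?_
  rw [Finset.mul_sum]
  refine Finset.sum_congr rfl fun q _ => ?_
  have hs : (Fin.snocEquiv fun _ => Fin k → Fin n) (q, p) =
      (Fin.snoc p q : Fin (T + 2) → Fin k → Fin n) := rfl
  rw [hs, prefixProb_snoc, mul_assoc]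
  have h3 : (Fin.snoc p q : Fin (T + 2) → Fin k → Fin n) (Fin.last (T + 1)) = q :=
    Fin.snoc_last (α := fun _ => Fin k → Fin n) q p
  rw [h3, greenSet_succ]
  congr 3
  have e2 : (fun a => (Fin.snoc p q : Fin (T + 2) → Fin k → Fin n)
      ⟨min (T + 1) (T + 1), Nat.lt_succ_of_le (min_le_right _ _)⟩ a) = q :=
    Eq.trans (congrArg (Fin.snoc p q : Fin (T + 2) → Fin k → Fin n) (Fin.ext (min_self _))) h3
  rw [e2]
  congr 1
  refine greenSet_congr fun s hs => ?_
  have e4 : (⟨min s (T + 1), Nat.lt_succ_of_le (min_le_right _ _)⟩ : Fin (T + 2)) =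
      (⟨min s T, Nat.lt_succ_of_le (min_le_right _ _)⟩ : Fin (T + 1)).castSucc := by
    ext
    simp only [Fin.val_castSucc]
    omega
  funext a
  rw [e4]
  exact congrFun (Fin.snoc_castSucc (α := fun _ => Fin k → Fin n) q p _) a

lemma expState_zero {n k : ℕ} (hk : 0 < k) (F : (Fin k → Fin n) → Finset (Fin k) → ℝ) :
    expState n k 0 F =
      ∑ q : Fin k → Fin n, (∏ _a : Fin k, (n : ℝ)⁻¹) * F q (spread {(⟨0, hk⟩ : Fin k)} q) := by
  rw [expState, ← (Equiv.funUnique (Fin 1) (Fin k → Fin n)).symm.sum_comp]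
  refine Finset.sum_congr rfl fun q _ => ?_
  rw [greenSet_zero hk]
  simp [prefixProb]

lemma expState_mono {n k : ℕ} (hn : 2 ≤ n) (hk : 0 < k) (T : ℕ)
    {F G : (Fin k → Fin n) → Finset (Fin k) → ℝ} (h : ∀ x S, S.Nonempty → F x S ≤ G x S) :
    expState n k T F ≤ expState n k T G :=
  Finset.sum_le_sum fun p _ => mul_le_mul_of_nonneg_left (h _ _ (greenSet_nonempty hk _ _))
    (prefixProb_nonneg hn k T p)

lemma expState_const_mul (n k T : ℕ) (c : ℝ) (F : (Fin k → Fin n) → Finset (Fin k) → ℝ) :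
    expState n k T (fun x S => c * F x S) = c * expState n k T F := by
  rw [expState, expState, Finset.mul_sum]
  exact Finset.sum_congr rfl fun p _ => by ring

lemma expState_sub (n k T : ℕ) (F G : (Fin k → Fin n) → Finset (Fin k) → ℝ) :
    expState n k T (fun x S => F x S - G x S) = expState n k T F - expState n k T G := by
  rw [expState, expState, expState, ← Finset.sum_sub_distrib]
  exact Finset.sum_congr rfl fun p _ => by ring

lemma expState_one {n k : ℕ} (hn : 2 ≤ n) (hk : 0 < k) (T : ℕ) :
    expState n k T (fun _ _ => 1) = 1 := by
  induction T with
  | zero =>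
    rw [expState_zero hk]
    simp only [mul_one]
    refine sum_prod_eq_one (κ := fun (_ : Fin k) (_ : Fin n) => (n : ℝ)⁻¹) fun _ => ?_
    have : (n : ℝ) ≠ 0 := by positivity
    simp [this]
  | succ T ih =>
    rw [expState_succ]
    simp only [mul_one]
    rw [← ih]
    congr 1
    funext x S
    exact sum_prod_eq_one (κ := fun a => stepProb n (x a)) fun a => sum_stepProb hn _

lemma expState_drift {n k : ℕ} (hn : 2 ≤ n) (hk : 0 < k) {Φ : Finset (Fin k) → ℝ} {r : ℝ}
    (hr : 0 ≤ r)
    (h : ∀ (x : Fin k → Fin n) (S : Finset (Fin k)), S.Nonempty →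
      ∑ q : Fin k → Fin n, (∏ a, stepProb n (x a) (q a)) * Φ (spread S q) ≤ r * Φ S) (T : ℕ) :
    expState n k T (fun _ S => Φ S) ≤ r ^ T * expState n k 0 (fun _ S => Φ S) := by
  induction T with
  | zero => simp
  | succ T ih =>
    rw [expState_succ]
    calc _ ≤ expState n k T fun _ S => r * Φ S := expState_mono hn hk T h
      _ ≤ _ := by
        rw [expState_const_mul, pow_succ', mul_assoc]
        exact mul_le_mul_of_nonneg_left ih hr

lemma probXiLe_eq (n k T : ℕ) :
    probXiLe n k T = expState n k T fun _ S => if S = Finset.univ then 1 else 0 := by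
  rw [probXiLe, expState]
  exact Finset.sum_congr rfl fun p _ => by split_ifs <;> simp

lemma probXiLe_le_succ {n k : ℕ} (hn : 2 ≤ n) (hk : 0 < k) (T : ℕ) :
    probXiLe n k T ≤ probXiLe n k (T + 1) := by
  rw [probXiLe_eq, probXiLe_eq, expState_succ]
  refine expState_mono hn hk T fun x S _ => ?_
  split_ifs with h
  · have : ∀ q : Fin k → Fin n, spread S q = Finset.univ := fun q => by
      rw [spread, h]
      exact Finset.union_eq_left.2 (Finset.subset_univ _)
    simp only [this, if_true, mul_one]
    exact (sum_prod_eq_one (κ := fun a => stepProb n (x a)) fun a => sum_stepProb hn _).ge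
  · refine Finset.sum_nonneg fun q _ => mul_nonneg
      (Finset.prod_nonneg fun a _ => stepProb_nonneg hn _ _) ?_
    split_ifs <;> simp

lemma probXiLe_nonneg {n k : ℕ} (hn : 2 ≤ n) (T : ℕ) : 0 ≤ probXiLe n k T :=
  Finset.sum_nonneg fun p _ => by
    split_ifs
    · exact prefixProb_nonneg hn k T p
    · rfl

lemma probXiLe_le_one {n k : ℕ} (hn : 2 ≤ n) (hk : 0 < k) (T : ℕ) : probXiLe n k T ≤ 1 := by
  rw [probXiLe_eq]
  refine (expState_mono hn hk T fun x S _ => ?_).trans (expState_one hn hk T).le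
  split_ifs <;> simp

lemma probXiLe_le {n k : ℕ} (hk : 0 < k) (hkn : k + 2 ≤ n) (T : ℕ) :
    probXiLe n k T ≤
      (1 + ((k : ℝ) + 1) / ((n : ℝ) - 1 - k)) ^ (T + 1) / (k : ℝ) ^ 2 := by
  have hn : 2 ≤ n := by omega
  have hkn' : (k : ℝ) + 2 ≤ n := by exact_mod_cast hkn
  have hk' : (0:ℝ) < k := by exact_mod_cast hk
  have hn1 : (0:ℝ) < (n:ℝ) - 1 := by linarith
  have hc0 : 0 ≤ ((n : ℝ) - 1)⁻¹ := inv_nonneg.2 hn1.le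
  have hkc : k * ((n : ℝ) - 1)⁻¹ < 1 := by
    rw [← div_eq_mul_inv, div_lt_one hn1]; linarith
  have hr : ((k : ℝ) + 1) * ((n : ℝ) - 1)⁻¹ / (1 - k * ((n : ℝ) - 1)⁻¹) =
      ((k : ℝ) + 1) / ((n : ℝ) - 1 - k) := by
    have : (n:ℝ) - 1 - k ≠ 0 := by linarith
    have h3 : 1 - k * ((n : ℝ) - 1)⁻¹ ≠ 0 := by linarith
    rw [div_eq_div_iff h3 this]
    field_simp
  have hpos : 0 < 1 + ((k : ℝ) + 1) / ((n : ℝ) - 1 - k) := by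
    have : 0 < (n:ℝ) - 1 - k := by linarith
    positivity
  set r := 1 + ((k : ℝ) + 1) / ((n : ℝ) - 1 - k) with hrdef
  have hT := expState_drift (n := n) hn hk (r := r)
    (Φ := fun S => (S.card : ℝ) / (k + 1 - S.card)) hpos.le (fun x S _ => by
      have := sum_lower_potential_le S (κ := fun a => stepProb n (x a))
        (fun a v => stepProb_nonneg hn _ _) (fun a => sum_stepProb hn _)
        (fun a v => stepProb_le hn _ _) hc0 hkc
      rwa [hr] at this) T
  have h0 : expState n k 0 (fun _ S => (S.card : ℝ) / (k + 1 - S.card)) ≤ r * (1 / k) := by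
    rw [expState_zero hk]
    have hn0 : (0:ℝ) < n := by linarith
    have := sum_lower_potential_le {(⟨0, hk⟩ : Fin k)} (κ := fun _ (_ : Fin n) => (n : ℝ)⁻¹)
        (fun a v => by positivity) (fun a => by simp [hn0.ne'])
        (fun a v => inv_anti₀ hn1 (by linarith)) hc0 hkc
    rw [hr] at this
    simpa using this
  have h1 : k * probXiLe n k T ≤ expState n k T (fun _ S => (S.card : ℝ) / (k + 1 - S.card)) := by
    rw [probXiLe_eq, ← expState_const_mul]
    refine expState_mono hn hk T fun x S _ => ?_
    split_ifs with h
    · simp [h]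
    · have : (S.card : ℝ) ≤ k := by exact_mod_cast (by simpa using Finset.card_le_univ S)
      rw [mul_zero]
      exact div_nonneg (by positivity) (by linarith)
  have h2 : k * probXiLe n k T ≤ r ^ T * (r * (1 / k)) :=
    h1.trans (hT.trans (mul_le_mul_of_nonneg_left h0 (by positivity)))
  calc probXiLe n k T = (k * probXiLe n k T) / k := by field_simp
    _ ≤ (r ^ T * (r * (1 / k))) / k := by gcongr
    _ = _ := by
        rw [pow_succ]
        field_simp

lemma one_sub_probXiLe_le {n k : ℕ} (hk : 2 ≤ k) (hkn : k + 2 ≤ n) (T : ℕ) {ρ : ℝ}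
    (hρ : ρ ≤ ((k : ℝ) / 2 - 1 / 4) * (((n : ℝ) - 1)⁻¹ * (1 - ((n : ℝ) - 1)⁻¹)) /
      ((1 + k * ((n : ℝ) - 1)⁻¹) * (1 + k ^ 2 * ((n : ℝ) - 1)⁻¹))) (hρ1 : ρ ≤ 1) :
    1 - probXiLe n k T ≤ 4 * k * (1 - ρ) ^ T := by
  have hn : 2 ≤ n := by omega
  have hk0 : 0 < k := by omega
  have hn' : (2 : ℝ) ≤ n := by exact_mod_cast hn
  have hc0 : 0 ≤ ((n : ℝ) - 1)⁻¹ := inv_nonneg.2 (by linarith)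
  have hc1 : ((n : ℝ) - 1)⁻¹ ≤ 1 := inv_le_one_of_one_le₀ (by linarith)
  have hr : 0 ≤ 1 - ρ := by linarith
  have hT := expState_drift (n := n) hn hk0 (Φ := fun S => upperPotential k S.card) hr
    (fun x S hS => by
      refine (sum_upperPotential_le hS (κ := fun a => stepProb n (x a))
        (fun a v => stepProb_nonneg hn _ _) (fun a => sum_stepProb hn _)
        (fun a v => stepProb_le hn _ _) hc0 (mul_nonneg hc0 (by linarith))
        (fun a b => sum_stepProb_mul_ge hn _ _)).trans ?_
      exact mul_le_mul_of_nonneg_right (by linarith) (upperPotential_nonneg _ _)) T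
  have hD := centralProd_pos (k - 1)
  have h0 : expState n k 0 (fun _ S => upperPotential k S.card) ≤ 1 / centralProd (k - 1) := by
    have h := expState_mono (n := n) hn hk0 0 (F := fun _ S => upperPotential k S.card)
      (G := fun _ _ => 1 / centralProd (k - 1) * 1) (fun x S hS => by
        rw [mul_one]
        refine (upperPotential_anti (Nat.succ_le_of_lt hS.card_pos)).trans ?_
        simp [upperPotential, show 1 < k by omega, centralProd])
    rwa [expState_const_mul n k 0 _ fun _ _ => 1, expState_one hn hk0, mul_one] at h
  have h1 : centralProd (k - 1) * (1 - probXiLe n k T) ≤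
      expState n k T (fun _ S => upperPotential k S.card) := by
    have hone : 1 - probXiLe n k T =
        expState n k T (fun _ S => 1 - if S = Finset.univ then 1 else 0) := by
      rw [expState_sub, expState_one hn hk0, probXiLe_eq]
    rw [hone, ← expState_const_mul]
    refine expState_mono hn hk0 T fun x S _ => ?_
    split_ifs with h
    · simpa using upperPotential_nonneg k _
    · rw [sub_zero, mul_one]
      refine upperPotential_ge ?_
      have := Finset.card_lt_univ_of_notMem (s := S)
        (Classical.choose_spec (not_forall.1 (mt Finset.eq_univ_iff_forall.2 h)))
      simpa using this
  have hsq : 1 / (4 * (k : ℝ)) ≤ centralProd (k - 1) ^ 2 := by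
    obtain ⟨m, rfl⟩ : ∃ m, k = m + 2 := ⟨k - 2, by omega⟩
    refine le_trans ?_ (centralProd_sq_ge m)
    push_cast
    gcongr
    norm_num
  have h2 : centralProd (k - 1) * (1 - probXiLe n k T) ≤ (1 - ρ) ^ T * (1 / centralProd (k - 1)) :=
    h1.trans (hT.trans (mul_le_mul_of_nonneg_left h0 (by positivity)))
  have h3 : centralProd (k - 1) ^ 2 * (1 - probXiLe n k T) ≤ (1 - ρ) ^ T := by
    calc _ = centralProd (k - 1) * (centralProd (k - 1) * (1 - probXiLe n k T)) := by ring
      _ ≤ centralProd (k - 1) * ((1 - ρ) ^ T * (1 / centralProd (k - 1))) := by gcongr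
      _ = _ := by field_simp
  have hk' : (0:ℝ) < k := by exact_mod_cast hk0
  have h4 : 1 / (4 * (k:ℝ)) * (1 - probXiLe n k T) ≤ (1 - ρ) ^ T :=
    (mul_le_mul_of_nonneg_right hsq (by linarith [probXiLe_le_one (k := k) hn hk0 T])).trans h3
  calc _ = 4 * k * (1 / (4 * (k:ℝ)) * (1 - probXiLe n k T)) := by field_simp
    _ ≤ _ := by gcongr

lemma sum_range_probXiEq (n k B : ℕ) :
    ∑ t ∈ Finset.range (B + 1), probXiEq n k t = probXiLe n k B := by
  induction B with
  | zero => simp [probXiEq]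
  | succ B ih =>
    rw [Finset.sum_range_succ, ih, probXiEq]
    ring

lemma probXiEq_nonneg {n k : ℕ} (hn : 2 ≤ n) (hk : 0 < k) (t : ℕ) : 0 ≤ probXiEq n k t := by
  cases t with
  | zero => exact probXiLe_nonneg hn 0
  | succ t => exact sub_nonneg.2 (probXiLe_le_succ hn hk t)

lemma probXiMem_bounds {n k : ℕ} (hn : 2 ≤ n) (hk : 0 < k) {S : Set ℕ} {A B : ℕ}
    (hS : ∀ t, t ∈ S ↔ A ≤ t ∧ t ≤ B) :
    probXiLe n k B - probXiLe n k A ≤ probXiMem n k S ∧ probXiMem n k S ≤ 1 := by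
  have hmem : probXiMem n k S =
      ∑ t ∈ Finset.range (B + 1), S.indicator (probXiEq n k) t := by
    refine tsum_eq_sum fun t ht => Set.indicator_of_notMem (fun h => ht ?_) _
    exact Finset.mem_range.2 (Nat.lt_succ_of_le ((hS t).1 h).2)
  have hnn := probXiEq_nonneg hn hk
  rw [hmem]
  constructor
  · rw [sub_le_iff_le_add, ← sum_range_probXiEq n k B, ← sum_range_probXiEq n k A]
    calc _ ≤ ∑ t ∈ Finset.range (B + 1), (S.indicator (probXiEq n k) t +
          if t ∈ Finset.range (A + 1) then probXiEq n k t else 0) := by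
          refine Finset.sum_le_sum fun t ht => ?_
          by_cases hA : A ≤ t
          · rw [Set.indicator_of_mem ((hS t).2 ⟨hA, Nat.le_of_lt_succ (Finset.mem_range.1 ht)⟩)]
            have : 0 ≤ if t ∈ Finset.range (A + 1) then probXiEq n k t else 0 := by
              split_ifs
              · exact hnn t
              · rfl
            linarith
          · rw [if_pos (Finset.mem_range.2 (by omega))]
            linarith [Set.indicator_nonneg (s := S) (fun t _ => hnn t) t]
      _ ≤ _ := by
          rw [Finset.sum_add_distrib, Finset.sum_ite_mem]
          exact add_le_add_right (Finset.sum_le_sum_of_subset_of_nonneg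
            Finset.inter_subset_right fun t _ _ => hnn t) _
  · calc _ ≤ ∑ t ∈ Finset.range (B + 1), probXiEq n k t :=
          Finset.sum_le_sum fun t _ => Set.indicator_le_self' (fun t _ => hnn t) t
      _ ≤ 1 := by
          rw [sum_range_probXiEq]
          exact probXiLe_le_one hn hk B

lemma probXiLe_ceil_le {n k : ℕ} (hk : 3 ≤ k) (hkn : 1000 * (k : ℝ) ^ 3 ≤ n) {e : ℝ}
    (he0 : 0 ≤ e) (he1 : e ≤ 1) :
    probXiLe n k ⌈(1 - e) * (2 * n * Real.log k / k)⌉₊ ≤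
      Real.exp (10 - e * Real.log k) := by
  have hk3 : (3:ℝ) ≤ k := by exact_mod_cast hk
  have hkn2 : (k : ℝ) ^ 2 * 3000 ≤ n := by nlinarith [sq_nonneg (k:ℝ)]
  have hknN : k + 2 ≤ n := by
    have : (k:ℝ) + 2 ≤ n := by nlinarith
    exact_mod_cast this
  set L := Real.log k with hL
  have hL0 : 0 ≤ L := Real.log_nonneg (by linarith)
  have hLk : L ≤ k := (Real.log_le_self (by linarith))
  set z : ℝ := ((k : ℝ) + 1) / ((n : ℝ) - 1 - k) with hz
  have hden : 0 < (n : ℝ) - 1 - k := by nlinarith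
  have hz0 : 0 ≤ z := by positivity
  have hz1 : z ≤ 1 := by rw [hz, div_le_one hden]; nlinarith
  have hM0 : 0 ≤ 2 * n * L / k := by positivity
  set A := ⌈(1 - e) * (2 * n * L / k)⌉₊
  have hA : (A : ℝ) ≤ (1 - e) * (2 * n * L / k) + 1 :=
    (Nat.ceil_lt_add_one (mul_nonneg (by linarith) hM0)).le
  have hzM : z * (2 * n * L / k) ≤ 2 * L + 6 * (L / k) := by
    have hzn : z * n ≤ k + 3 := by
      rw [hz, div_mul_eq_mul_div, div_le_iff₀ hden]
      nlinarith
    calc _ = z * n * (2 * L / k) := by ring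
      _ ≤ (k + 3) * (2 * L / k) := by gcongr
      _ = _ := by field_simp; ring
  have hLk1 : L / k ≤ 1 := (div_le_one (by linarith)).2 hLk
  have hLk0 : 0 ≤ L / k := by positivity
  have hexp : z * (A + 1) - 2 * L ≤ 10 - e * L := by
    have h1 : z * (A + 1) ≤ z * ((1 - e) * (2 * n * L / k) + 2) :=
      mul_le_mul_of_nonneg_left (by linarith) hz0
    have h2 : (1 - e) * (z * (2 * n * L / k)) ≤ (1 - e) * (2 * L + 6 * (L / k)) :=
      mul_le_mul_of_nonneg_left hzM (by linarith)
    have h3 : (1 - e) * (6 * (L / k)) ≤ 6 := by nlinarith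
    nlinarith [mul_nonneg he0 hL0]
  calc _ ≤ (1 + z) ^ (A + 1) / (k : ℝ) ^ 2 := probXiLe_le (by omega) hknN A
    _ ≤ Real.exp (z * (A + 1)) / Real.exp (2 * L) := by
      have h1 : Real.exp (2 * L) = (k : ℝ) ^ 2 := by
        rw [two_mul, Real.exp_add, hL, Real.exp_log (by linarith), sq]
      have h2 : Real.exp (z * (A + 1)) = Real.exp z ^ (A + 1) := by
        rw [← Real.exp_nat_mul]; push_cast; ring_nf
      rw [h1, h2]
      gcongr
      linarith [Real.add_one_le_exp z]
    _ = Real.exp (z * (A + 1) - 2 * L) := (Real.exp_sub _ _).symm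
    _ ≤ _ := Real.exp_le_exp.2 hexp

lemma one_sub_probXiLe_floor_le {n k : ℕ} (hk : 3 ≤ k) (hkn : 1000 * (k : ℝ) ^ 3 ≤ n) {e : ℝ}
    (he0 : 0 ≤ e) (he1 : e ≤ 1) :
    1 - probXiLe n k ⌊(1 + e) * (2 * n * Real.log k / k)⌋₊ ≤
      Real.exp (10 - e * Real.log k) := by
  have hk3 : (3:ℝ) ≤ k := by exact_mod_cast hk
  have hkn2 : (k : ℝ) ^ 2 * 3000 ≤ n := by nlinarith [sq_nonneg (k:ℝ)]
  have hknN : k + 2 ≤ n := by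
    have : (k:ℝ) + 2 ≤ n := by nlinarith
    exact_mod_cast this
  set L := Real.log k with hL
  have hL0 : 0 ≤ L := Real.log_nonneg (by linarith)
  have hLk : L ≤ k := (Real.log_le_self (by linarith))
  have hn0 : (0:ℝ) < n := by nlinarith
  have hn1 : (0:ℝ) < (n:ℝ) - 1 := by nlinarith
  set ρ : ℝ := ((k : ℝ) - 2) / (2 * n) with hρ
  have hρ0 : 0 ≤ ρ := div_nonneg (by linarith) (by linarith)
  have hρ1 : ρ ≤ 1 := by rw [hρ, div_le_one (by linarith)]; nlinarith
  have hρle : ρ ≤ ((k : ℝ) / 2 - 1 / 4) * (((n : ℝ) - 1)⁻¹ * (1 - ((n : ℝ) - 1)⁻¹)) /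
      ((1 + k * ((n : ℝ) - 1)⁻¹) * (1 + k ^ 2 * ((n : ℝ) - 1)⁻¹)) := by
    set c := ((n : ℝ) - 1)⁻¹ with hc
    have hc0 : 0 < c := inv_pos.2 hn1
    have hnc : (n:ℝ)⁻¹ ≤ c := inv_anti₀ hn1 (by linarith)
    have hkc : (k : ℝ) ^ 3 * c ≤ 1 / 900 := by
      rw [hc, ← div_eq_mul_inv, div_le_iff₀ hn1]
      nlinarith [pow_pos (show (0:ℝ) < k by linarith) 3]
    have hk2c : (k : ℝ) ^ 2 * c * k ≤ 1 / 900 := by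
      calc _ = (k : ℝ) ^ 3 * c := by ring
        _ ≤ _ := hkc
    have hk2c0 : 0 ≤ (k : ℝ) ^ 2 * c := by positivity
    have hk2c' : (k : ℝ) ^ 2 * c ≤ 1 / 900 := by nlinarith
    have hk1c : k * c ≤ (k : ℝ) ^ 2 * c := by nlinarith
    have hk1c0 : 0 ≤ k * c := by positivity
    have hden : (1 + k * c) * (1 + k ^ 2 * c) ≤ 1 + 3 * (k ^ 2 * c) := by nlinarith
    have hnum : ((k : ℝ) - 2) * (1 + 3 * (k ^ 2 * c)) ≤ (k - 1 / 2) * (1 - c) := by nlinarith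
    rw [le_div_iff₀ (by positivity)]
    calc _ ≤ ρ * (1 + 3 * (k ^ 2 * c)) := by gcongr
      _ = (n:ℝ)⁻¹ / 2 * (((k : ℝ) - 2) * (1 + 3 * (k ^ 2 * c))) := by rw [hρ]; field_simp
      _ ≤ c / 2 * (((k : ℝ) - 2) * (1 + 3 * (k ^ 2 * c))) := by
        have : 0 ≤ ((k : ℝ) - 2) * (1 + 3 * (k ^ 2 * c)) := by
          apply mul_nonneg <;> linarith
        gcongr
      _ ≤ c / 2 * ((k - 1 / 2) * (1 - c)) := by gcongr
      _ = _ := by ring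
  set B := ⌊(1 + e) * (2 * n * L / k)⌋₊
  have hB : (1 + e) * (2 * n * L / k) - 1 ≤ B := (Nat.sub_one_lt_floor _).le
  have hρM : ρ * (2 * n * L / k) = L - 2 * (L / k) := by rw [hρ]; field_simp
  have hLk1 : L / k ≤ 1 := (div_le_one (by linarith)).2 hLk
  have hLk0 : 0 ≤ L / k := by positivity
  have hexp : 2 + L - ρ * B ≤ 10 - e * L := by
    have h1 : ρ * ((1 + e) * (2 * n * L / k) - 1) ≤ ρ * B := mul_le_mul_of_nonneg_left hB hρ0
    have h2 : ρ * ((1 + e) * (2 * n * L / k) - 1) = (1 + e) * (L - 2 * (L / k)) - ρ := by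
      rw [← hρM]; ring
    nlinarith
  calc _ ≤ 4 * k * (1 - ρ) ^ B := one_sub_probXiLe_le (by omega) hknN B hρle hρ1
    _ ≤ Real.exp 2 * Real.exp L * Real.exp (-(ρ * B)) := by
      have h1 : Real.exp L = k := by rw [hL, Real.exp_log (by linarith)]
      have h2 : Real.exp (-(ρ * B)) = Real.exp (-ρ) ^ B := by
        rw [← Real.exp_nat_mul]; ring_nf
      have h3 : (4:ℝ) ≤ Real.exp 2 := by
        have : Real.exp 2 = Real.exp 1 * Real.exp 1 := by rw [← Real.exp_add]; norm_num
        rw [this]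
        nlinarith [Real.add_one_le_exp (1:ℝ)]
      rw [h1, h2]
      have : 0 ≤ 1 - ρ := by linarith
      gcongr
      linarith [Real.add_one_le_exp (-ρ)]
    _ = Real.exp (2 + L - ρ * B) := by rw [← Real.exp_add, ← Real.exp_add]; ring_nf
    _ ≤ _ := Real.exp_le_exp.2 hexp

lemma eventually_cube_le {k : ℕ → ℕ}
    (hko : Tendsto (fun n => (k n : ℝ) / (((n : ℝ) / Real.log n) ^ ((1 : ℝ) / 3)))
      atTop (nhds 0)) :
    ∀ᶠ n : ℕ in atTop, 1000 * (k n : ℝ) ^ 3 ≤ n := by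
  filter_upwards [hko.eventually_lt_const (show (0:ℝ) < 1 / 10 by norm_num),
    eventually_ge_atTop 3] with n hn h3
  have hn3 : (3:ℝ) ≤ n := by exact_mod_cast h3
  have hlog : 1 ≤ Real.log n := by
    rw [Real.le_log_iff_exp_le (by linarith)]
    linarith [Real.exp_one_lt_d9]
  have hq : 0 < (n : ℝ) / Real.log n := by positivity
  set x := ((n : ℝ) / Real.log n) ^ ((1 : ℝ) / 3) with hx
  have hx0 : 0 < x := Real.rpow_pos_of_pos hq _
  have hx3 : x ^ 3 = (n : ℝ) / Real.log n := by
    rw [hx, ← Real.rpow_natCast, ← Real.rpow_mul hq.le]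
    norm_num
  rw [div_lt_iff₀ hx0] at hn
  calc 1000 * (k n : ℝ) ^ 3 ≤ 1000 * (1 / 10 * x) ^ 3 := by gcongr
    _ = x ^ 3 := by ring
    _ ≤ n := by
      rw [hx3]
      exact div_le_self (by linarith) hlog

/-- **Theorem 4.1 (second part).**  If `k = k(n) → ∞` and `k = o((n/ln n)^{1/3})`, then there is
a constant `C > 0` such that a.a.s. `|ξ(K_n,k)·k/(2 n ln k) − 1| ≤ C/(ln k)^{1/3}`. -/
theorem broadcasting_time_growing_small_k
    (k : ℕ → ℕ) (hk : Tendsto k atTop atTop)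
    (hko : Tendsto (fun n => (k n : ℝ) / (((n : ℝ) / Real.log n) ^ ((1 : ℝ) / 3)))
      atTop (nhds 0)) :
    ∃ C > (0:ℝ), Tendsto (fun n =>
        probXiMem n (k n) {t |
          |(t : ℝ) * (k n) / (2 * n * Real.log (k n)) - 1|
            ≤ C / (Real.log (k n)) ^ ((1 : ℝ) / 3)})
      atTop (nhds 1) := by
  refine ⟨1, one_pos, ?_⟩
  have hL : Tendsto (fun n => Real.log (k n)) atTop atTop :=
    Real.tendsto_log_atTop.comp (tendsto_natCast_atTop_atTop.comp hk)
  have hlim : Tendsto (fun n => 1 - 2 * Real.exp (10 - Real.log (k n) ^ ((2 : ℝ) / 3)))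
      atTop (nhds 1) := by
    have h1 : Tendsto (fun n => 10 - Real.log (k n) ^ ((2 : ℝ) / 3)) atTop atBot :=
      tendsto_const_nhds.add_atBot (tendsto_neg_atTop_atBot.comp
        ((tendsto_rpow_atTop (by norm_num)).comp hL))
    simpa using ((Real.tendsto_exp_atBot.comp h1).const_mul 2).const_sub 1
  have hall : ∀ᶠ n in atTop,
      1 - 2 * Real.exp (10 - Real.log (k n) ^ ((2 : ℝ) / 3)) ≤
        probXiMem n (k n) {t | |(t : ℝ) * (k n) / (2 * n * Real.log (k n)) - 1|
            ≤ 1 / (Real.log (k n)) ^ ((1 : ℝ) / 3)} ∧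
      probXiMem n (k n) {t | |(t : ℝ) * (k n) / (2 * n * Real.log (k n)) - 1|
            ≤ 1 / (Real.log (k n)) ^ ((1 : ℝ) / 3)} ≤ 1 := by
    filter_upwards [eventually_cube_le hko, hk.eventually_ge_atTop 3, hL.eventually_ge_atTop 1]
      with n hcube hk3 hL1
    have hk3' : (3:ℝ) ≤ k n := by exact_mod_cast hk3
    have hn3 : (3:ℝ) ≤ n := by nlinarith [pow_le_pow_left₀ (by norm_num) hk3' 3]
    have hn2 : 2 ≤ n := by
      have : (2:ℝ) ≤ n := by linarith
      exact_mod_cast this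
    set L := Real.log (k n)
    have hroot : 1 ≤ L ^ ((1 : ℝ) / 3) := Real.one_le_rpow hL1 (by norm_num)
    set e := 1 / L ^ ((1 : ℝ) / 3) with he
    have he0 : 0 ≤ e := by positivity
    have he1 : e ≤ 1 := (div_le_one (by linarith)).2 hroot
    have heL : e * L = L ^ ((2 : ℝ) / 3) := by
      rw [he, one_div, ← Real.rpow_neg (by linarith)]
      nth_rewrite 2 [← Real.rpow_one L]
      rw [← Real.rpow_add (by linarith)]
      norm_num
    have hM : 0 < 2 * n * L / k n := by positivity
    have hlow := probXiLe_ceil_le hk3 hcube he0 he1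
    have hupp := one_sub_probXiLe_floor_le hk3 hcube he0 he1
    rw [heL] at hlow hupp
    have hbd := probXiMem_bounds hn2 (show 0 < k n by omega)
      (S := {t : ℕ | |(t : ℝ) * (k n) / (2 * n * L) - 1| ≤ e})
      (A := ⌈(1 - e) * (2 * n * L / k n)⌉₊) (B := ⌊(1 + e) * (2 * n * L / k n)⌋₊) (by
        intro t
        have ht : (t : ℝ) * (k n) / (2 * n * L) = t / (2 * n * L / k n) := by
          rw [div_div_eq_mul_div]
        rw [Set.mem_ofPred_eq, ht, abs_le, Nat.ceil_le, Nat.le_floor_iff (by positivity),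
          ← le_div_iff₀ hM, ← div_le_iff₀ hM]
        constructor <;> rintro ⟨h1, h2⟩ <;> constructor <;> linarith)
    exact ⟨by linarith [hbd.1], hbd.2⟩
  exact tendsto_of_tendsto_of_tendsto_of_le_of_le' hlim tendsto_const_nhds
    (hall.mono fun n h => h.1) (hall.mono fun n h => h.2)
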